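/- Let m, n, r be positive integers, λ > 0, ρ > 0, and let f : ℝ^{m×n} → ℝ be differentiable with λ-Lipschitz gradient, i.e., ‖∇f(X) − ∇f(Y)‖ ≤ λ‖X − Y‖ for all X, Y ∈ ℝ^{m×n}. Then for every W ∈ ℝ^{m×n} and every fixed matrix Z ∈ ℝ^{m×n}, the finite-difference TeZO estimate deviates from its ρ → 0 limit by at most ‖ (1/r) ∇⁰f(W) − (1/r) ⟨∇f(W), Z⟩ · Z ‖² ≤ (ρ² λ² / (4 r²)) ‖Z‖⁶, where ∇⁰f(W) = ((f(W + ρZ) − f(W − ρZ))/(2ρ)) · Z and ‖·‖ is the Frobenius norm. -/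

import Mathlib

open MeasureTheory ProbabilityTheory
open scoped RealInnerProductSpace

/-- The symmetric difference of a function with `L`-Lipschitz gradient is approximated to second
order by its directional derivative. -/
lemma abs_symmetric_difference_sub_inner_gradient_le {E : Type*} [NormedAddCommGroup E]
    [InnerProductSpace ℝ E] [CompleteSpace E] {f : E → ℝ} {L ρ : ℝ} (hρ : 0 ≤ ρ)
    (hdiff : Differentiable ℝ f)
    (hlip : ∀ X Y : E, ‖gradient f X - gradient f Y‖ ≤ L * ‖X - Y‖) (W Z : E) :
    |f (W + ρ • Z) - f (W - ρ • Z) - 2 * ρ * ⟪gradient f W, Z⟫| ≤ L * ρ ^ 2 * ‖Z‖ ^ 2 := by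
  have hline (V : E) (t : ℝ) :
      HasDerivAt (fun s : ℝ => f (W + s • V)) ⟪gradient f (W + t • V), V⟫ t := by
    have hpath : HasDerivAt (fun s : ℝ => W + s • V) V t := by
      simpa using ((hasDerivAt_id t).smul_const V).const_add W
    simpa [Function.comp_def] using
      (hdiff (W + t • V)).hasGradientAt.hasFDerivAt.comp_hasDerivAt t hpath
  have hderiv (t : ℝ) :
      HasDerivAt (fun s : ℝ => f (W + s • Z) - f (W + s • -Z) - 2 * s * ⟪gradient f W, Z⟫)
        (⟪gradient f (W + t • Z) - gradient f W, Z⟫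
          + ⟪gradient f (W + t • -Z) - gradient f W, Z⟫) t := by
    have hlin : HasDerivAt (fun s : ℝ => 2 * s * ⟪gradient f W, Z⟫) (2 * ⟪gradient f W, Z⟫) t := by
      simpa using ((hasDerivAt_id t).const_mul 2).mul_const ⟪gradient f W, Z⟫
    refine (((hline Z t).sub (hline (-Z) t)).sub hlin).congr_deriv ?_
    simp only [inner_sub_left, inner_neg_right]
    ring
  have hinner (V : E) (hV : ‖V‖ = ‖Z‖) (t : ℝ) (ht : 0 ≤ t) :
      |⟪gradient f (W + t • V) - gradient f W, Z⟫| ≤ L * t * ‖Z‖ ^ 2 := by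
    have hgrad : ‖gradient f (W + t • V) - gradient f W‖ ≤ L * (t * ‖Z‖) := by
      simpa [norm_smul, abs_of_nonneg ht, hV] using hlip (W + t • V) W
    calc
      _ ≤ ‖gradient f (W + t • V) - gradient f W‖ * ‖Z‖ := abs_real_inner_le_norm _ _
      _ ≤ L * (t * ‖Z‖) * ‖Z‖ := by gcongr
      _ = L * t * ‖Z‖ ^ 2 := by ring
  have hbound (t : ℝ) :
      HasDerivAt (fun s : ℝ => L * s ^ 2 * ‖Z‖ ^ 2) (2 * (L * t * ‖Z‖ ^ 2)) t := by
    refine (((hasDerivAt_pow 2 t).const_mul L).mul_const (‖Z‖ ^ 2)).congr_deriv ?_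
    push_cast
    ring
  have h := image_norm_le_of_norm_deriv_right_le_deriv_boundary (a := 0) (b := ρ)
    (fun t _ => (hderiv t).continuousAt.continuousWithinAt)
    (fun t _ => (hderiv t).hasDerivWithinAt) (by simp) hbound
    (fun t ht => by
      have h₁ := hinner Z rfl t ht.1
      have h₂ := hinner (-Z) (norm_neg Z) t ht.1
      rw [Real.norm_eq_abs]
      exact (abs_add_le _ _).trans (by linarith))
    (Set.right_mem_Icc.2 hρ)
  simpa only [Real.norm_eq_abs, smul_neg, ← sub_eq_add_neg] using h

/-- if `f : ℝ^{m×n} → ℝ` is differentiable with `L`-Lipschitz gradient,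
then for every `W` and every fixed `Z`, the finite-difference TeZO estimate deviates
from its `ρ → 0` limit by at most
`‖(1/r) ∇⁰f(W) − (1/r) ⟨∇f(W), Z⟩ • Z‖² ≤ (ρ² L² / (4r²)) ‖Z‖⁶`,
where `∇⁰f(W) = ((f(W + ρZ) − f(W − ρZ))/(2ρ)) • Z` (Frobenius norms). -/
theorem tezo_finite_difference_error (m n r : ℕ) (hm : 0 < m) (hn : 0 < n) (hr : 0 < r)
    (L ρ : ℝ) (hL : 0 < L) (hρ : 0 < ρ)
    (f : EuclideanSpace ℝ (Fin m × Fin n) → ℝ)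
    (hdiff : Differentiable ℝ f)
    (hlip : ∀ X Y : EuclideanSpace ℝ (Fin m × Fin n),
      ‖gradient f X - gradient f Y‖ ≤ L * ‖X - Y‖)
    (W Z : EuclideanSpace ℝ (Fin m × Fin n)) :
    ‖(1 / (r : ℝ)) • (((f (W + ρ • Z) - f (W - ρ • Z)) / (2 * ρ)) • Z)
        - (1 / (r : ℝ)) • (⟪gradient f W, Z⟫ • Z)‖ ^ 2
      ≤ ρ ^ 2 * L ^ 2 / (4 * (r : ℝ) ^ 2) * ‖Z‖ ^ 6 := by
  have h := abs_symmetric_difference_sub_inner_gradient_le hρ.le hdiff hlip W Z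
  set d := f (W + ρ • Z) - f (W - ρ • Z)
  set c : ℝ := ⟪gradient f W, Z⟫
  have hr' : (0 : ℝ) < r := by exact_mod_cast hr
  have hsq : (d - 2 * ρ * c) ^ 2 ≤ (L * ρ ^ 2 * ‖Z‖ ^ 2) ^ 2 :=
    sq_le_sq' (abs_le.1 h).1 (abs_le.1 h).2
  rw [← smul_sub, ← sub_smul, smul_smul, norm_smul, mul_pow, Real.norm_eq_abs, sq_abs]
  calc
    (1 / (r : ℝ) * (d / (2 * ρ) - c)) ^ 2 * ‖Z‖ ^ 2
        = (d - 2 * ρ * c) ^ 2 * (‖Z‖ ^ 2 / (4 * ρ ^ 2 * (r : ℝ) ^ 2)) := by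
      field_simp
      ring
    _ ≤ (L * ρ ^ 2 * ‖Z‖ ^ 2) ^ 2 * (‖Z‖ ^ 2 / (4 * ρ ^ 2 * (r : ℝ) ^ 2)) := by gcongr
    _ = ρ ^ 2 * L ^ 2 / (4 * (r : ℝ) ^ 2) * ‖Z‖ ^ 6 := by
      field_simp
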